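/- Assume that 3SAT does not have polynomial-size Boolean circuits, i.e., there is no polynomial function p : ℕ → ℕ such that for every k ≥ 1 some Boolean circuit over 8k^3 inputs of size at most p(8k^3) computes 3SAT(k). Define 3SAT* from Bool* to Bool by: 3SAT*(b) = 3SAT(k)(b) if the length of b equals 8k^3 for some k ≥ 1, and 3SAT*(b) = f otherwise. Then there is a polynomial function h : ℕ → ℕ such that for every n ∈ ℕ the restriction of 3SAT* to Bool^n is computed by some instruction sequence (backward jumps allowed) of length at most h(n), but there is no polynomial function h' : ℕ → ℕ such that for every n ∈ ℕ the restriction of 3SAT* to Bool^n is computed by some loop-free instruction sequence of length at most h'(n). Consequently the class IS^lf_P of partial functions computable by polynomial-length loop-free instruction sequences is a proper subset of the class IS_P of partial functions computable by polynomial-length instruction sequences. -/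

import Mathlib

/-- A focus (register name): an input register `in:i` or an auxiliary register `aux:i`. -/
inductive Focus
  | inp (i : ℕ)
  | aux (i : ℕ)
  deriving DecidableEq

/-- A method of a Boolean register service. -/
inductive Method
  | setT
  | setF
  | get
  deriving DecidableEq

/-- A PGLB_bt primitive instruction. -/
inductive Instr
  | basic (f : Focus) (m : Method)   -- f.m
  | pos (f : Focus) (m : Method)     -- +f.m
  | neg (f : Focus) (m : Method)     -- -f.m
  | fjmp (l : ℕ)                     -- #l
  | bjmp (l : ℕ)                     -- \#l
  | termT                            -- !t
  | termF                            -- !f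
  deriving DecidableEq

/-- A state assigns to every register a value in {t, f, d}; `none` represents `d`. -/
abbrev St := Focus → Option Bool

/-- The reply produced when processing method `m` on a register holding `x`. -/
def procReply (m : Method) (x : Option Bool) : Option Bool :=
  match x, m with
  | none, _ => none
  | some b, .get => some b
  | some _, .setT => some true
  | some _, .setF => some true

/-- The new register value after processing method `m` on a register holding `x`. -/
def procEff (m : Method) (x : Option Bool) : Option Bool :=
  match x, m with
  | none, _ => none
  | some b, .get => some b
  | some _, .setT => some true
  | some _, .setF => some false

/-- Update a state by processing method `m` on the register named `f`. -/
def updSt (s : St) (f : Focus) (m : Method) : St :=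
  fun g => if g = f then procEff m (s f) else s g

/-- An execution configuration: running at a (1-based) position in a state,
terminated with a reply (recording the final state), or deadlocked. -/
inductive Config
  | running (i : ℕ) (s : St)
  | terminated (r : Bool) (s : St)
  | deadlock

/-- One execution step of the instruction sequence `I`. -/
def step (I : List Instr) : Config → Config
  | .terminated r s => .terminated r s
  | .deadlock => .deadlock
  | .running i s =>
    if i = 0 then .deadlock
    else
      match I[i - 1]? with
      | none => .deadlock
      | some u =>
        match u with
        | .basic f m =>
          match procReply m (s f) with
          | none => .deadlock
          | some _ => .running (i + 1) (updSt s f m)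
        | .pos f m =>
          match procReply m (s f) with
          | none => .deadlock
          | some true => .running (i + 1) (updSt s f m)
          | some false => .running (i + 2) (updSt s f m)
        | .neg f m =>
          match procReply m (s f) with
          | none => .deadlock
          | some true => .running (i + 2) (updSt s f m)
          | some false => .running (i + 1) (updSt s f m)
        | .fjmp l => .running (i + l) s
        | .bjmp l => if l < i then .running (i - l) s else .deadlock
        | .termT => .terminated true s
        | .termF => .terminated false s

/-- The configuration after `n` execution steps of `I`, starting at position 1 in state `s`. -/
def run (I : List Instr) (s : St) (n : ℕ) : Config :=
  (step I)^[n] (.running 1 s)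

/-- Execution of `I` from state `s` terminates with reply `r`. -/
def TermWith (I : List Instr) (s : St) (r : Bool) : Prop :=
  ∃ n s', run I s n = .terminated r s'

/-- An instruction sequence is loop-free if it contains no backward jump. -/
def LoopFree (I : List Instr) : Prop := ∀ l, Instr.bjmp l ∉ I

/-- An instruction refers to an auxiliary register. -/
def UsesAux : Instr → Prop
  | .basic (.aux _) _ => True
  | .pos (.aux _) _ => True
  | .neg (.aux _) _ => True
  | _ => False

/-- The initial state for computing a `k`-ary function using `l` auxiliary registers:
`in:i` holds `b_i` for `1 ≤ i ≤ k`, `aux:j` holds `t` for `1 ≤ j ≤ l`,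
all other registers hold `d`. -/
def initSt (k l : ℕ) (b : Fin k → Bool) : St
  | .inp i => if h : 1 ≤ i ∧ i ≤ k then some (b ⟨i - 1, by omega⟩) else none
  | .aux j => if 1 ≤ j ∧ j ≤ l then some true else none

/-- `I` computes the partial function `F : Bool^k ⇀ Bool` using `l` auxiliary registers. -/
def Computes (I : List Instr) (k l : ℕ) (F : (Fin k → Bool) → Option Bool) : Prop :=
  ∀ b : Fin k → Bool,
    (∀ r : Bool, F b = some r → TermWith I (initSt k l b) r) ∧
    (F b = none → ∀ r : Bool, ¬ TermWith I (initSt k l b) r)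

/-- An argument of a gate: an input `x_j` or an earlier gate `g_m` (both 1-based). -/
inductive GateArg
  | input (j : ℕ)
  | gate (m : ℕ)

/-- A gate of a Boolean circuit. -/
inductive Gate
  | not (p : GateArg)
  | and (p q : GateArg)
  | or (p q : GateArg)

/-- The value of a gate argument, given the input vector `b` and the list `vals` of
values of the earlier gates. -/
def argVal (k : ℕ) (b : Fin k → Bool) (vals : List Bool) : GateArg → Bool
  | .input j => if h : 1 ≤ j ∧ j ≤ k then b ⟨j - 1, by omega⟩ else false
  | .gate m => vals.getD (m - 1) false

/-- The value of a gate, given the input vector and the values of the earlier gates. -/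
def gateVal (k : ℕ) (b : Fin k → Bool) (vals : List Bool) : Gate → Bool
  | .not p => ! argVal k b vals p
  | .and p q => argVal k b vals p && argVal k b vals q
  | .or p q => argVal k b vals p || argVal k b vals q

/-- The list of values of all gates of the circuit `C` on input `b`. -/
def evalCircuit (k : ℕ) (b : Fin k → Bool) (C : List Gate) : List Bool :=
  C.foldl (fun vals g => vals ++ [gateVal k b vals g]) []

/-- The output of the circuit `C` on input `b`: the value of its last gate. -/
def circuitVal (k : ℕ) (b : Fin k → Bool) (C : List Gate) : Bool :=
  (evalCircuit k b C).getLast?.getD false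

/-- Well-formedness of a gate argument occurring in the gate with (1-based) index `idx`
of a circuit over `k` inputs: it refers to an input `x_j` with `1 ≤ j ≤ k` or to an
earlier gate. -/
def ArgWF (k idx : ℕ) : GateArg → Prop
  | .input j => 1 ≤ j ∧ j ≤ k
  | .gate m => 1 ≤ m ∧ m < idx

/-- Well-formedness of the gate with (1-based) index `idx`. -/
def GateWF (k idx : ℕ) : Gate → Prop
  | .not p => ArgWF k idx p
  | .and p q => ArgWF k idx p ∧ ArgWF k idx q
  | .or p q => ArgWF k idx p ∧ ArgWF k idx q

/-- A well-formed Boolean circuit over `k` inputs: a nonempty list of well-formed gates. -/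
def CircuitWF (k : ℕ) (C : List Gate) : Prop :=
  C ≠ [] ∧ ∀ (idx : ℕ) (g : Gate), C[idx]? = some g → GateWF k (idx + 1) g

/-- `posTest true f = +f.get` and `posTest false f = -f.get`. -/
def polTest (pb : Bool) (f : Focus) : Instr :=
  if pb then .pos f .get else .neg f .get

/-- Sign of the first literal of the clause `γ_(l,m,n,i)`: positive iff `i ∈ {1,2,3,4}`. -/
def sgn1 (i : ℕ) : Bool := decide (i ≤ 4)

/-- Sign of the second literal of `γ_(l,m,n,i)`: positive iff `i ∈ {1,2,5,6}`. -/
def sgn2 (i : ℕ) : Bool := decide (i = 1 ∨ i = 2 ∨ i = 5 ∨ i = 6)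

/-- Sign of the third literal of `γ_(l,m,n,i)`: positive iff `i` is odd. -/
def sgn3 (i : ℕ) : Bool := decide (i % 2 = 1)

/-- The assignment `a` satisfies the 3-clause `γ_(l,m,n,i)`,
i.e. makes at least one of its three literals true. -/
def SatClause (a : ℕ → Bool) : ℕ × ℕ × ℕ × ℕ → Prop
  | (l, m, n, i) => a l = sgn1 i ∨ a m = sgn2 i ∨ a n = sgn3 i

/-- `CHECK_(l,m,n,i) = T₁ aux:l.get; #2; T₂ aux:m.get; #2; T₃ aux:n.get`. -/
def CHECKc : ℕ × ℕ × ℕ × ℕ → List Instr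
  | (l, m, n, i) =>
    [polTest (sgn1 i) (.aux l), .fjmp 2, polTest (sgn2 i) (.aux m), .fjmp 2,
     polTest (sgn3 i) (.aux n)]

/-- The `m`-th guarded check (for a total of `K` clauses):
`-in:m.get; #8; CHECK_{φ(m)}; #2; #9` if `m < K`, and
`-in:K.get; #6; CHECK_{φ(K)}; !t` if `m = K`. -/
def guarded (K : ℕ) (φ : ℕ → ℕ × ℕ × ℕ × ℕ) (m : ℕ) : List Instr :=
  if m < K then
    [.neg (.inp m) .get, .fjmp 8] ++ CHECKc (φ m) ++ [.fjmp 2, .fjmp 9]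
  else
    [.neg (.inp m) .get, .fjmp 6] ++ CHECKc (φ m) ++ [.termT]

/-- `CHECK`: the concatenation of the guarded checks for `m = 1, …, 8k³`. -/
def CHECKseq (k : ℕ) (φ : ℕ → ℕ × ℕ × ℕ × ℕ) : List Instr :=
  (List.range (8 * k ^ 3)).flatMap fun j => guarded (8 * k ^ 3) φ (j + 1)

/-- The 3-CNF encoded by the Boolean sequence `b` of length `8k³` (clause `γ_{φ(m)}`
is present iff the `m`-th entry of `b` is `t`) is satisfiable. -/
def SatFormula (k : ℕ) (φ : ℕ → ℕ × ℕ × ℕ × ℕ) (b : List Bool) : Prop :=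
  ∃ a : ℕ → Bool, ∀ m : ℕ, 1 ≤ m → m ≤ 8 * k ^ 3 →
    b.getD (m - 1) false = true → SatClause a (φ m)

/-- The restriction of a partial function on `Bool*` to `Bool^k`. -/
def Restrict (F : List Bool → Option Bool) (k : ℕ) : (Fin k → Bool) → Option Bool :=
  fun b => F (List.ofFn b)

attribute [local instance] Classical.propDecidable

/-- `3SAT* : Bool* → Bool`, i.e. `3SAT(k)` on inputs of length `8k³` (`k ≥ 1`) and
constantly `f` on inputs of other lengths. -/
noncomputable def threeSATstar (φ : ℕ → ℕ → ℕ × ℕ × ℕ × ℕ) (b : List Bool) : Bool :=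
  if h : ∃ k : ℕ, 1 ≤ k ∧ b.length = 8 * k ^ 3 then
    (if SatFormula h.choose (φ h.choose) b then true else false)
  else false

/-- `IS^lf_P`: partial functions on `Bool*` all of whose restrictions are computable by
loop-free instruction sequences of polynomial length. -/
def ISlfP (F : List Bool → Option Bool) : Prop :=
  ∃ p : Polynomial ℕ, ∀ k : ℕ,
    ∃ I : List Instr, I ≠ [] ∧ LoopFree I ∧ I.length ≤ p.eval k ∧
      ∃ l : ℕ, Computes I k l (Restrict F k)

/-- `IS_P`: partial functions on `Bool*` all of whose restrictions are computable by
instruction sequences (backward jumps allowed) of polynomial length. -/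
def ISP (F : List Bool → Option Bool) : Prop :=
  ∃ p : Polynomial ℕ, ∀ k : ℕ,
    ∃ I : List Instr, I ≠ [] ∧ I.length ≤ p.eval k ∧
      ∃ l : ℕ, Computes I k l (Restrict F k)

/-! ### Executions -/

/-- Execution of `I` from the configuration `c` terminates with reply `r`. -/
def TermFrom (I : List Instr) (c : Config) (r : Bool) : Prop :=
  ∃ n s', (step I)^[n] c = .terminated r s'

theorem TermFrom.of_step {I : List Instr} {c : Config} {r : Bool}
    (h : TermFrom I (step I c) r) : TermFrom I c r := by
  obtain ⟨n, s', h⟩ := h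
  exact ⟨n + 1, s', by rwa [Function.iterate_succ_apply]⟩

theorem TermFrom.step {I : List Instr} {i : ℕ} {s : St} {r : Bool}
    (h : TermFrom I (.running i s) r) : TermFrom I (step I (.running i s)) r := by
  obtain ⟨n, s', h⟩ := h
  cases n with
  | zero => simp at h
  | succ n => exact ⟨n, s', by rwa [Function.iterate_succ_apply] at h⟩

theorem not_termFrom_deadlock {I : List Instr} {r : Bool} : ¬ TermFrom I .deadlock r := by
  rintro ⟨n, s', h⟩
  rw [Function.iterate_fixed rfl] at h
  cases h

theorem termFrom_terminated {I : List Instr} {r r' : Bool} {s : St} :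
    TermFrom I (.terminated r' s) r ↔ r' = r := by
  constructor
  · rintro ⟨n, s', h⟩
    rw [Function.iterate_fixed rfl] at h
    cases h
    rfl
  · rintro rfl
    exact ⟨0, s, rfl⟩

theorem not_termFrom_running_of_fixed {I : List Instr} {r : Bool} {i : ℕ} {s : St}
    (h : step I (.running i s) = .running i s) : ¬ TermFrom I (.running i s) r := by
  rintro ⟨n, s', h'⟩
  rw [Function.iterate_fixed h] at h'
  cases h'

theorem updSt_get (s : St) (f : Focus) : updSt s f .get = s := by
  funext g
  unfold updSt
  split_ifs with h
  · subst h
    unfold procEff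
    cases s g <;> rfl
  · rfl

/-! ### Circuits for loop-free instruction sequences -/

/-- The function `g` is the value of an input or of a gate of the circuit `C`. -/
def Avail (K : ℕ) (C : List Gate) (g : (Fin K → Bool) → Bool) : Prop :=
  ∃ a, ArgWF K (C.length + 1) a ∧ ∀ b, argVal K b (evalCircuit K b C) a = g b

/-- All functions in `fs` are available in a single circuit of size at most `n`. -/
def JointlyComputable (K n : ℕ) (fs : Set ((Fin K → Bool) → Bool)) : Prop :=
  ∃ C : List Gate, (∀ (idx : ℕ) (g : Gate), C[idx]? = some g → GateWF K (idx + 1) g) ∧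
    C.length ≤ n ∧ ∀ g ∈ fs, Avail K C g

theorem evalCircuit_concat (K : ℕ) (b : Fin K → Bool) (C : List Gate) (g : Gate) :
    evalCircuit K b (C ++ [g]) = evalCircuit K b C ++ [gateVal K b (evalCircuit K b C) g] := by
  simp [evalCircuit]

theorem length_evalCircuit (K : ℕ) (b : Fin K → Bool) (C : List Gate) :
    (evalCircuit K b C).length = C.length := by
  induction C using List.reverseRecOn with
  | nil => rfl
  | append_singleton C g ih => simp [evalCircuit_concat, ih]

theorem Avail.concat {K : ℕ} {C : List Gate} {f : (Fin K → Bool) → Bool}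
    (h : Avail K C f) (g : Gate) : Avail K (C ++ [g]) f := by
  obtain ⟨a, ha, hv⟩ := h
  cases a with
  | input j => exact ⟨.input j, ha, hv⟩
  | gate m =>
    simp only [ArgWF] at ha
    refine ⟨.gate m, ?_, fun b => ?_⟩
    · simp only [ArgWF, List.length_append, List.length_singleton]
      omega
    · rw [← hv b, evalCircuit_concat]
      simp only [argVal]
      rw [List.getD_append]
      rw [length_evalCircuit]
      omega

theorem avail_concat_last {K : ℕ} (C : List Gate) (g : Gate) :
    Avail K (C ++ [g]) fun b => gateVal K b (evalCircuit K b C) g := by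
  refine ⟨.gate (C.length + 1), by simp [ArgWF], fun b => ?_⟩
  rw [evalCircuit_concat]
  simp only [argVal]
  rw [List.getD_append_right _ _ _ _ (by simp [length_evalCircuit])]
  simp [length_evalCircuit]

theorem gatesWF_concat {K : ℕ} {C : List Gate} {g : Gate}
    (hC : ∀ (idx : ℕ) (g : Gate), C[idx]? = some g → GateWF K (idx + 1) g)
    (hg : GateWF K (C.length + 1) g) (idx : ℕ) (g' : Gate)
    (h : (C ++ [g])[idx]? = some g') : GateWF K (idx + 1) g' := by
  rcases lt_trichotomy idx C.length with hlt | rfl | hgt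
  · rw [List.getElem?_append_left hlt] at h
    exact hC idx g' h
  · simp only [List.getElem?_concat_length, Option.some.injEq] at h
    exact h ▸ hg
  · rw [List.getElem?_eq_none (by simp; omega)] at h
    cases h

namespace JointlyComputable

variable {K n : ℕ} {fs : Set ((Fin K → Bool) → Bool)} {f g : (Fin K → Bool) → Bool}

theorem mono {n' : ℕ} {fs' : Set ((Fin K → Bool) → Bool)} (h : JointlyComputable K n fs)
    (hn : n ≤ n') (hfs : fs' ⊆ fs) : JointlyComputable K n' fs' := by
  obtain ⟨C, hC, hl, ha⟩ := h
  exact ⟨C, hC, hl.trans hn, fun g hg => ha g (hfs hg)⟩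

theorem insert_and (h : JointlyComputable K n fs) (hf : f ∈ fs) (hg : g ∈ fs) :
    JointlyComputable K (n + 1) (insert (fun b => f b && g b) fs) := by
  obtain ⟨C, hC, hl, ha⟩ := h
  obtain ⟨x, hx, hxv⟩ := ha f hf
  obtain ⟨y, hy, hyv⟩ := ha g hg
  refine ⟨C ++ [.and x y], gatesWF_concat (g := .and x y) hC ⟨hx, hy⟩, by simpa using hl, ?_⟩
  rintro e (rfl | he)
  · simpa [gateVal, hxv, hyv] using avail_concat_last (K := K) C (.and x y)
  · exact (ha e he).concat _

theorem insert_or (h : JointlyComputable K n fs) (hf : f ∈ fs) (hg : g ∈ fs) :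
    JointlyComputable K (n + 1) (insert (fun b => f b || g b) fs) := by
  obtain ⟨C, hC, hl, ha⟩ := h
  obtain ⟨x, hx, hxv⟩ := ha f hf
  obtain ⟨y, hy, hyv⟩ := ha g hg
  refine ⟨C ++ [.or x y], gatesWF_concat (g := .or x y) hC ⟨hx, hy⟩, by simpa using hl, ?_⟩
  rintro e (rfl | he)
  · simpa [gateVal, hxv, hyv] using avail_concat_last (K := K) C (.or x y)
  · exact (ha e he).concat _

theorem insert_not (h : JointlyComputable K n fs) (hf : f ∈ fs) :
    JointlyComputable K (n + 1) (insert (fun b => !f b) fs) := by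
  obtain ⟨C, hC, hl, ha⟩ := h
  obtain ⟨x, hx, hxv⟩ := ha f hf
  refine ⟨C ++ [.not x], gatesWF_concat (g := .not x) hC hx, by simpa using hl, ?_⟩
  rintro e (rfl | he)
  · simpa [gateVal, hxv] using avail_concat_last (K := K) C (.not x)
  · exact (ha e he).concat _

theorem exists_circuit (h : JointlyComputable K n fs) (hf : f ∈ fs) :
    ∃ C : List Gate, CircuitWF K C ∧ C.length ≤ n + 1 ∧ ∀ b, circuitVal K b C = f b := by
  obtain ⟨C, hC, hl, ha⟩ := h
  obtain ⟨x, hx, hxv⟩ := ha f hf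
  refine ⟨C ++ [.or x x], ⟨by simp, gatesWF_concat (g := .or x x) hC ⟨hx, hx⟩⟩,
    by simpa using hl, fun b => ?_⟩
  simp [circuitVal, evalCircuit_concat, gateVal, hxv]

end JointlyComputable

/-- The Boolean data tracked when simulating a loop-free instruction sequence by a circuit:
which positions have been reached, the contents of the registers, and whether execution has
terminated with reply `t`. -/
structure Trace where
  reach : ℕ → Bool
  reg : Focus → Bool
  out : Bool

namespace Trace

/-- The reply to method `m` on register `f`. -/
def reply (T : Trace) (f : Focus) : Method → Bool
  | .get => T.reg f
  | _ => true

/-- Mark position `j` as reached if `c` holds. -/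
def mark (T : Trace) (j : ℕ) (c : Bool) : Trace :=
  { T with reach := Function.update T.reach j (T.reach j || c) }

/-- Perform method `m` on register `f` if `c` holds. -/
def operate (T : Trace) (f : Focus) (c : Bool) : Method → Trace
  | .get => T
  | .setT => { T with reg := Function.update T.reg f (T.reg f || c) }
  | .setF => { T with reg := Function.update T.reg f (T.reg f && !c) }

/-- The effect of instruction `u` at position `i`. -/
def exec (T : Trace) (i : ℕ) : Instr → Trace
  | .basic f m => (T.mark (i + 1) (T.reach i)).operate f (T.reach i) m
  | .pos f m => ((T.mark (i + 1) (T.reach i && T.reply f m)).mark (i + 2)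
      (T.reach i && !T.reply f m)).operate f (T.reach i) m
  | .neg f m => ((T.mark (i + 1) (T.reach i && !T.reply f m)).mark (i + 2)
      (T.reach i && T.reply f m)).operate f (T.reach i) m
  | .fjmp l => T.mark (i + l) (T.reach i)
  | .bjmp _ => T
  | .termT => { T with out := T.out || T.reach i }
  | .termF => T

/-- The effect of the instructions `L`, the first of which is at position `i`. -/
def execList : List Instr → ℕ → Trace → Trace
  | [], _, T => T
  | u :: L, i, T => execList L (i + 1) (T.exec i u)

/-- The functions of the input given by the components of a trace. -/
def components {K : ℕ} (T : (Fin K → Bool) → Trace) : Set ((Fin K → Bool) → Bool) :=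
  {g | (∃ j, g = fun b => (T b).reach j) ∨ (∃ f, g = fun b => (T b).reg f) ∨
    g = fun b => (T b).out}

theorem reach_mem {K : ℕ} (T : (Fin K → Bool) → Trace) (j : ℕ) :
    (fun b => (T b).reach j) ∈ components T := Or.inl ⟨j, rfl⟩

theorem reg_mem {K : ℕ} (T : (Fin K → Bool) → Trace) (f : Focus) :
    (fun b => (T b).reg f) ∈ components T := Or.inr (Or.inl ⟨f, rfl⟩)

theorem out_mem {K : ℕ} (T : (Fin K → Bool) → Trace) :
    (fun b => (T b).out) ∈ components T := Or.inr (Or.inr rfl)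

theorem components_mark {K : ℕ} (T : (Fin K → Bool) → Trace) (j : ℕ)
    (c : (Fin K → Bool) → Bool) :
    components (fun b => (T b).mark j (c b)) ⊆
      insert (fun b => (T b).reach j || c b) (components T) := by
  rintro g (⟨j', rfl⟩ | ⟨f, rfl⟩ | rfl)
  · by_cases h : j' = j
    · subst h
      left
      simp [mark]
    · right
      left
      exact ⟨j', by simp [mark, h]⟩
  · exact Or.inr (reg_mem T f)
  · exact Or.inr (out_mem T)

variable {K n : ℕ} {T : (Fin K → Bool) → Trace} {fs : Set ((Fin K → Bool) → Bool)}
  {c : (Fin K → Bool) → Bool}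

theorem jointlyComputable_mark (h : JointlyComputable K n (components T ∪ fs))
    (hc : c ∈ components T ∪ fs) (j : ℕ) :
    JointlyComputable K (n + 1) (components (fun b => (T b).mark j (c b)) ∪ fs) := by
  refine (h.insert_or (Or.inl (reach_mem T j)) hc).mono le_rfl ?_
  rw [← Set.insert_union]
  exact Set.union_subset_union_left _ (components_mark T j c)

theorem components_update_reg (v : (Fin K → Bool) → Bool) (f : Focus) :
    components (fun b => { T b with reg := Function.update (T b).reg f (v b) }) ⊆
      insert v (components T) := by
  rintro g (⟨j, rfl⟩ | ⟨f', rfl⟩ | rfl)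
  · exact Or.inr (reach_mem T j)
  · by_cases h : f' = f
    · subst h
      left
      simp
    · right
      right
      left
      exact ⟨f', by simp [h]⟩
  · exact Or.inr (out_mem T)

theorem jointlyComputable_operate (h : JointlyComputable K n (components T ∪ fs))
    (hc : c ∈ components T ∪ fs) (f : Focus) (m : Method) :
    JointlyComputable K (n + 2) (components (fun b => (T b).operate f (c b) m) ∪ fs) := by
  cases m with
  | get => exact h.mono (by omega) subset_rfl
  | setT =>
    refine (h.insert_or (Or.inl (reg_mem T f)) hc).mono (by omega) ?_
    rw [← Set.insert_union]
    exact Set.union_subset_union_left _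
      (components_update_reg (fun b => (T b).reg f || c b) f)
  | setF =>
    refine ((h.insert_not hc).insert_and (Or.inr (Or.inl (reg_mem T f)))
      (Set.mem_insert _ _)).mono (by omega) ?_
    refine (Set.union_subset_union_left _
      (components_update_reg (fun b => (T b).reg f && !c b) f)).trans ?_
    rw [Set.insert_union]
    exact Set.insert_subset_insert (Set.subset_insert _ _)

/-- Both constant functions. -/
def consts (K : ℕ) : Set ((Fin K → Bool) → Bool) := {fun _ => true, fun _ => false}

theorem reply_mem (f : Focus) (m : Method) :
    (fun b => (T b).reply f m) ∈ components T ∪ consts K := by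
  cases m with
  | get => exact Or.inl (reg_mem T f)
  | setT => exact Or.inr (Or.inl rfl)
  | setF => exact Or.inr (Or.inl rfl)

theorem jointlyComputable_branch (h : JointlyComputable K n fs)
    (hT : components T ∪ consts K ⊆ fs) {c₁ c₂ : (Fin K → Bool) → Bool} (h₁ : c₁ ∈ fs)
    (h₂ : c₂ ∈ fs) (i : ℕ) (f : Focus) (m : Method) :
    JointlyComputable K (n + 4) (components (fun b => (((T b).mark (i + 1) (c₁ b)).mark
      (i + 2) (c₂ b)).operate f ((T b).reach i) m) ∪ consts K) := by
  have h0 : JointlyComputable K n (components T ∪ fs) :=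
    h.mono le_rfl (Set.union_subset (Set.subset_union_left.trans hT) subset_rfl)
  refine (jointlyComputable_operate (jointlyComputable_mark (jointlyComputable_mark h0
    (Or.inr h₁) (i + 1)) (Or.inr h₂) (i + 2))
    (Or.inr (hT (Or.inl (reach_mem T i)))) f m).mono le_rfl ?_
  exact Set.union_subset_union_right _ (Set.subset_union_right.trans hT)

theorem jointlyComputable_exec (h : JointlyComputable K n (components T ∪ consts K))
    (i : ℕ) (u : Instr) :
    JointlyComputable K (n + 7) (components (fun b => (T b).exec i u) ∪ consts K) := by
  have hr : (fun b => (T b).reach i) ∈ components T ∪ consts K := Or.inl (reach_mem T i)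
  have hbranch (f : Focus) (m : Method) := (((h.insert_and hr (reply_mem f m)).insert_not
    (Or.inr (reply_mem f m))).insert_and (Or.inr (Or.inr hr)) (Set.mem_insert _ _))
  have hsub {a b c : (Fin K → Bool) → Bool} :
      components T ∪ consts K ⊆ insert a (insert b (insert c (components T ∪ consts K))) :=
    (Set.subset_insert _ _).trans ((Set.subset_insert _ _).trans (Set.subset_insert _ _))
  cases u with
  | basic f m =>
    refine JointlyComputable.mono (jointlyComputable_operate (jointlyComputable_mark
      (T := T) (fs := components T ∪ consts K) (h.mono le_rfl ?_) (Or.inr hr) (i + 1))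
      (Or.inr hr) f m) (by omega) ?_
    · exact Set.union_subset Set.subset_union_left subset_rfl
    · exact Set.union_subset_union_right _ Set.subset_union_right
  | pos f m =>
    exact jointlyComputable_branch (hbranch f m) hsub
      (Or.inr (Or.inr (Set.mem_insert _ _))) (Set.mem_insert _ _) i f m
  | neg f m =>
    exact jointlyComputable_branch (hbranch f m) hsub
      (Set.mem_insert _ _) (Or.inr (Or.inr (Set.mem_insert _ _))) i f m
  | fjmp l => exact (jointlyComputable_mark h hr (i + l)).mono (by omega) subset_rfl
  | bjmp l => exact h.mono (by omega) subset_rfl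
  | termT =>
    refine (h.insert_or (Or.inl (out_mem T)) hr).mono (by omega) ?_
    rw [← Set.insert_union]
    refine Set.union_subset_union_left _ ?_
    rintro g (⟨j, rfl⟩ | ⟨f, rfl⟩ | rfl)
    · exact Or.inr (reach_mem T j)
    · exact Or.inr (reg_mem T f)
    · exact Or.inl rfl
  | termF => exact h.mono (by omega) subset_rfl

theorem jointlyComputable_execList (L : List Instr) :
    ∀ {n : ℕ} {T : (Fin K → Bool) → Trace} (i : ℕ),
      JointlyComputable K n (components T ∪ consts K) →
      JointlyComputable K (n + 7 * L.length)
        (components (fun b => execList L i (T b)) ∪ consts K) := by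
  induction L with
  | nil => exact fun _ h => h
  | cons u L ih =>
    intro n T i h
    refine (ih (i + 1) (jointlyComputable_exec h i u)).mono ?_ subset_rfl
    simp only [List.length_cons]
    omega

/-- The trace at the start of an execution on input `b`. -/
def initial (K : ℕ) (b : Fin K → Bool) : Trace where
  reach j := j == 1
  reg f := (initSt K 0 b f).getD true
  out := false

theorem initSt_zero_aux {K : ℕ} (b : Fin K → Bool) (i : ℕ) : initSt K 0 b (.aux i) = none :=
  if_neg (by omega)

theorem jointlyComputable_initial (hK : 1 ≤ K) :
    JointlyComputable K 3 (components (initial K) ∪ consts K) := by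
  let x : (Fin K → Bool) → Bool := fun b => b ⟨0, hK⟩
  let inputs : Set ((Fin K → Bool) → Bool) := {g | ∃ j, g = fun b => b j}
  have h0 : JointlyComputable K 0 inputs := by
    refine ⟨[], by simp, by simp, ?_⟩
    rintro g ⟨j, rfl⟩
    refine ⟨.input (j + 1), ⟨by omega, j.2⟩, fun b => ?_⟩
    simp only [argVal]
    rw [dif_pos ⟨by omega, j.2⟩]
    simp
  have hx : x ∈ inputs := ⟨_, rfl⟩
  have h1 := ((h0.insert_not hx).insert_or (Or.inr hx) (Set.mem_insert _ _)).insert_and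
    (Or.inr (Or.inr hx)) (Or.inr (Set.mem_insert _ _))
  simp only [Bool.or_not_self, Bool.and_not_self] at h1
  have hc (c : Bool) : (fun _ : Fin K → Bool => c) ∈ insert (fun _ => false)
      (insert (fun _ => true) (insert (fun b => !x b) inputs)) := by
    cases c
    · exact Or.inl rfl
    · exact Or.inr (Or.inl rfl)
  refine h1.mono le_rfl ?_
  rintro g ((⟨j, rfl⟩ | ⟨f, rfl⟩ | rfl) | rfl | rfl)
  · exact hc _
  · cases f with
    | inp i =>
      by_cases hi : 1 ≤ i ∧ i ≤ K
      · exact Or.inr (Or.inr (Or.inr ⟨⟨i - 1, by omega⟩, by simp [initial, initSt, hi]⟩))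
      · simp [initial, initSt, hi]
    | aux i => simp [initial, initSt_zero_aux]
  · exact hc _
  · exact hc _
  · exact hc _

theorem exec_of_not_reach {T : Trace} {i : ℕ} (h : T.reach i = false) (u : Instr) :
    T.exec i u = T := by
  cases u with
  | basic f m => cases m <;> simp [exec, operate, mark, h]
  | pos f m => cases m <;> simp [exec, operate, mark, h]
  | neg f m => cases m <;> simp [exec, operate, mark, h]
  | _ => simp [exec, mark, h]

/-- The trace describes the configuration at position `j` in state `s`, where positions before
`i` have been dealt with. -/
structure Describes (T : Trace) (i j : ℕ) (s : St) : Prop where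
  le : i ≤ j
  reach_self : T.reach j = true
  reach_ne : ∀ j', i ≤ j' → j' ≠ j → T.reach j' = false
  reg_eq : ∀ f x, s f = some x → T.reg f = x
  out_eq : T.out = false

/-- From the trace one will find the reply `r`, either because execution continues and leads
to `r` or because it has already done so. -/
def Sound (I : List Instr) (i : ℕ) (T : Trace) (r : Bool) : Prop :=
  (∃ j s, T.Describes i j s ∧ TermFrom I (.running j s) r) ∨
    (∀ j, i ≤ j → T.reach j = false) ∧ T.out = r

theorem Describes.next {T : Trace} {i j : ℕ} {s : St} (h : T.Describes i i s) (hj : i < j) :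
    (T.mark j true).Describes (i + 1) j s where
  le := hj
  reach_self := by simp [mark]
  reach_ne j' h1 h2 := by
    simp only [mark, Function.update_of_ne h2]
    exact h.reach_ne j' (by omega) (by omega)
  reg_eq := h.reg_eq
  out_eq := h.out_eq

theorem mark_false (T : Trace) (j : ℕ) : T.mark j false = T := by simp [mark]

theorem Describes.operate {T : Trace} {i j : ℕ} {s : St} (h : T.Describes i j s) (f : Focus)
    (m : Method) : (T.operate f true m).Describes i j (updSt s f m) := by
  obtain ⟨h1, h2, h3, h4, h5⟩ := h
  cases m with
  | get => exact ⟨h1, h2, h3, by rwa [updSt_get], h5⟩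
  | setT =>
    refine ⟨h1, h2, h3, fun g x hg => ?_, h5⟩
    by_cases hgf : g = f
    · subst hgf
      simp only [updSt, if_true] at hg
      cases hs : s g <;> simp_all [procEff, Trace.operate]
    · simp only [updSt, if_neg hgf] at hg
      simpa [Trace.operate, hgf] using h4 g x hg
  | setF =>
    refine ⟨h1, h2, h3, fun g x hg => ?_, h5⟩
    by_cases hgf : g = f
    · subst hgf
      simp only [updSt, if_true] at hg
      cases hs : s g <;> simp_all [procEff, Trace.operate]
    · simp only [updSt, if_neg hgf] at hg
      simpa [Trace.operate, hgf] using h4 g x hg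

theorem Describes.reply_eq {T : Trace} {i j : ℕ} {s : St} (h : T.Describes i j s) {f : Focus}
    {m : Method} {x : Bool} (hx : procReply m (s f) = some x) : T.reply f m = x := by
  cases hs : s f with
  | none => simp [hs, procReply] at hx
  | some y => cases m <;> simp_all [procReply, reply, h.reg_eq f y hs]

theorem Sound.exec {I : List Instr} {p : ℕ} {u : Instr} (hu : I[p]? = some u)
    (hlf : ∀ l, u ≠ .bjmp l) {T : Trace} {r : Bool} (h : Sound I (p + 1) T r) :
    Sound I (p + 2) (T.exec (p + 1) u) r := by
  by_cases hp : T.reach (p + 1) = true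
  swap
  · rw [exec_of_not_reach (by simpa using hp)]
    rcases h with ⟨j, s, hd, ht⟩ | ⟨h, ho⟩
    · refine Or.inl ⟨j, s, ⟨?_, hd.reach_self, fun j' h1 h2 => hd.reach_ne j' (by omega) h2,
        hd.reg_eq, hd.out_eq⟩, ht⟩
      rcases hd.le.eq_or_lt with rfl | hlt
      · exact absurd hd.reach_self hp
      · exact hlt
    · exact Or.inr ⟨fun j hj => h j (by omega), ho⟩
  rcases h with ⟨j, s, hd, ht⟩ | ⟨h, -⟩
  swap
  · simp [h (p + 1) le_rfl] at hp
  obtain rfl : p + 1 = j := by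
    by_contra hne
    simp [hd.reach_ne (p + 1) le_rfl hne] at hp
  have ht' := ht.step
  simp only [step, Nat.add_eq_zero_iff, one_ne_zero, and_false, if_false, Nat.add_sub_cancel,
    hu] at ht'
  cases u with
  | basic f m =>
    cases hx : procReply m (s f) with
    | none => simp only [hx] at ht'; exact absurd ht' not_termFrom_deadlock
    | some x =>
      simp only [hx] at ht'
      refine Or.inl ⟨_, _, ?_, ht'⟩
      simpa [Trace.exec, hp] using (hd.next (j := p + 2) (by omega)).operate f m
  | pos f m =>
    cases hx : procReply m (s f) with
    | none => simp only [hx] at ht'; exact absurd ht' not_termFrom_deadlock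
    | some x =>
      have hy := hd.reply_eq hx
      cases x <;> simp only [hx] at ht' <;> refine Or.inl ⟨_, _, ?_, ht'⟩
      · simpa [Trace.exec, hp, hy, mark_false] using
          (hd.next (j := p + 1 + 2) (by omega)).operate f m
      · simpa [Trace.exec, hp, hy, mark_false] using
          (hd.next (j := p + 1 + 1) (by omega)).operate f m
  | neg f m =>
    cases hx : procReply m (s f) with
    | none => simp only [hx] at ht'; exact absurd ht' not_termFrom_deadlock
    | some x =>
      have hy := hd.reply_eq hx
      cases x <;> simp only [hx] at ht' <;> refine Or.inl ⟨_, _, ?_, ht'⟩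
      · simpa [Trace.exec, hp, hy, mark_false] using
          (hd.next (j := p + 1 + 1) (by omega)).operate f m
      · simpa [Trace.exec, hp, hy, mark_false] using
          (hd.next (j := p + 1 + 2) (by omega)).operate f m
  | fjmp l =>
    rcases l.eq_zero_or_pos with rfl | hl
    · exact absurd ht (not_termFrom_running_of_fixed (by simp [step, hu]))
    · refine Or.inl ⟨_, _, ?_, ht'⟩
      simpa [Trace.exec, hp] using hd.next (j := p + 1 + l) (by omega)
  | bjmp l => exact absurd rfl (hlf l)
  | termT =>
    obtain rfl := termFrom_terminated.1 ht'
    exact Or.inr ⟨fun j hj => hd.reach_ne j (by omega) (by omega), by simp [Trace.exec, hp]⟩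
  | termF =>
    obtain rfl := termFrom_terminated.1 ht'
    exact Or.inr ⟨fun j hj => hd.reach_ne j (by omega) (by omega), by
      simp [Trace.exec, hd.out_eq]⟩

theorem Sound.execList_out {I : List Instr} (hI : LoopFree I) {r : Bool} (L : List Instr) :
    ∀ {pre : List Instr} {T : Trace}, I = pre ++ L → Sound I (pre.length + 1) T r →
      (execList L (pre.length + 1) T).out = r := by
  induction L with
  | nil =>
    intro pre T hpre h
    rcases h with ⟨j, s, hd, ht⟩ | ⟨-, h⟩
    · have hle := hd.le
      have hnone : I[j - 1]? = none := List.getElem?_eq_none (by simp [hpre]; omega)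
      have ht' := ht.step
      rw [show step I (.running j s) = .deadlock by simp [step, hnone]] at ht'
      exact absurd ht' not_termFrom_deadlock
    · exact h
  | cons u L ih =>
    intro pre T hpre h
    have hu : I[pre.length]? = some u := by simp [hpre]
    have := ih (pre := pre ++ [u]) (T := T.exec (pre.length + 1) u) (by simp [hpre])
      (by simpa using h.exec hu fun l hl => hI l (by simp [hpre, hl]))
    simpa [execList] using this

theorem execList_initial_out {I : List Instr} (hI : LoopFree I) {K l : ℕ} {b : Fin K → Bool}
    {r : Bool} (h : TermWith I (initSt K l b) r) : (execList I 1 (initial K b)).out = r := by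
  refine Sound.execList_out hI I (pre := []) rfl (Or.inl ⟨1, initSt K l b, ?_, h⟩)
  refine ⟨le_rfl, rfl, fun j' _ h => by simp [initial, h], fun f x hx => ?_, rfl⟩
  cases f with
  | inp i =>
    have : initSt K 0 b (.inp i) = some x := hx
    simp [initial, this]
  | aux i =>
    simp only [initSt] at hx
    split_ifs at hx
    simpa [initial, initSt_zero_aux] using hx

end Trace

/-- A total function computed by a loop-free instruction sequence is computed by a circuit of
linear size. -/
theorem exists_circuit_of_loopFree {I : List Instr} (hI : LoopFree I) {K l : ℕ} (hK : 1 ≤ K)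
    {F : (Fin K → Bool) → Bool} (h : Computes I K l fun b => some (F b)) :
    ∃ C : List Gate, CircuitWF K C ∧ C.length ≤ 7 * I.length + 4 ∧
      ∀ b, circuitVal K b C = F b := by
  obtain ⟨C, hC, hl, hv⟩ := (Trace.jointlyComputable_execList I 1
    (Trace.jointlyComputable_initial hK)).exists_circuit (Or.inl (Trace.out_mem _))
  refine ⟨C, hC, by omega, fun b => ?_⟩
  rw [hv b]
  exact Trace.execList_initial_out hI ((h b).1 _ rfl)


/-! ### Exhaustive search with backward jumps -/

namespace Search

/-- Part of a binary decrement of `aux:1, …, aux:k` (least significant bit first): if `aux:(i+1)`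
holds `t`, it is set to `f` and the decrement is complete; otherwise it is set to `t`, and the
next bit is to be treated. -/
def decInstr (k i : ℕ) : ℕ → Instr
  | 0 => .pos (.aux (i + 1)) .get
  | 1 => .neg (.aux (i + 1)) .setF
  | 2 => .neg (.aux (i + 1)) .setT
  | _ => .fjmp (4 * (k - i) - 2)

/-- Check of a clause, guarded by `in:(j+1)`: execution proceeds to the next check if the guard or
the clause holds, and jumps back to the decrement otherwise. -/
def clauseInstr (k j : ℕ) : ℕ × ℕ × ℕ × ℕ → ℕ → Instr
  | _, 0 => .neg (.inp (j + 1)) .get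
  | _, 1 => .fjmp 7
  | (l, _, _, i), 2 => polTest (sgn1 i) (.aux l)
  | _, 3 => .fjmp 5
  | (_, m, _, i), 4 => polTest (sgn2 i) (.aux m)
  | _, 5 => .fjmp 3
  | (_, _, n, i), 6 => polTest (!sgn3 i) (.aux n)
  | _, _ => .bjmp (4 * k + 8 * j + 8)

/-- The instruction at position `p + 1` of the search program for `K` clauses. -/
def instrAt (k K : ℕ) (φ : ℕ → ℕ × ℕ × ℕ × ℕ) (p : ℕ) : Instr :=
  if p = 0 then .fjmp (4 * k + 2)
  else if p < 4 * k + 1 then decInstr k ((p - 1) / 4) ((p - 1) % 4)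
  else if p = 4 * k + 1 then .termF
  else if p < 4 * k + 2 + 8 * K then
    clauseInstr k ((p - (4 * k + 2)) / 8) (φ ((p - (4 * k + 2)) / 8 + 1)) ((p - (4 * k + 2)) % 8)
  else .termT

/-- An instruction sequence searching through all assignments to `k` variables for one that
satisfies those of the clauses `φ 1, …, φ K` that are selected by the input. -/
def prog (k K : ℕ) (φ : ℕ → ℕ × ℕ × ℕ × ℕ) : List Instr :=
  (List.range (4 * k + 3 + 8 * K)).map (instrAt k K φ)

variable {k K : ℕ} {φ : ℕ → ℕ × ℕ × ℕ × ℕ}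

theorem prog_getElem? {p : ℕ} (hp : p < 4 * k + 3 + 8 * K) :
    (prog k K φ)[p]? = some (instrAt k K φ p) := by
  simp [prog, hp]

theorem prog_zero : (prog k K φ)[0]? = some (.fjmp (4 * k + 2)) := by
  rw [prog_getElem? (by omega)]
  rfl

theorem prog_dec {i r : ℕ} (hi : i < k) (hr : r < 4) :
    (prog k K φ)[1 + 4 * i + r]? = some (decInstr k i r) := by
  rw [prog_getElem? (by omega), instrAt, if_neg (by omega), if_pos (by omega),
    show (1 + 4 * i + r - 1) / 4 = i by omega, show (1 + 4 * i + r - 1) % 4 = r by omega]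

theorem prog_termF : (prog k K φ)[4 * k + 1]? = some .termF := by
  rw [prog_getElem? (by omega), instrAt, if_neg (by omega), if_neg (by omega), if_pos rfl]

theorem prog_clause {j r : ℕ} (hj : j < K) (hr : r < 8) :
    (prog k K φ)[4 * k + 2 + 8 * j + r]? = some (clauseInstr k j (φ (j + 1)) r) := by
  have h1 : (4 * k + 2 + 8 * j + r - (4 * k + 2)) / 8 = j := by omega
  have h2 : (4 * k + 2 + 8 * j + r - (4 * k + 2)) % 8 = r := by omega
  rw [prog_getElem? (by omega), instrAt, if_neg (by omega), if_neg (by omega), if_neg (by omega),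
    if_pos (by omega), h1, h2]

theorem prog_termT : (prog k K φ)[4 * k + 2 + 8 * K]? = some .termT := by
  rw [prog_getElem? (by omega), instrAt, if_neg (by omega), if_neg (by omega), if_neg (by omega),
    if_neg (by omega)]

section Steps

variable {I : List Instr} {p : ℕ} {s : St} {r : Bool}

theorem termFrom_fjmp {l : ℕ} (hu : I[p]? = some (.fjmp l))
    (h : TermFrom I (.running (p + 1 + l) s) r) : TermFrom I (.running (p + 1) s) r :=
  .of_step (by simpa [step, hu] using h)

theorem termFrom_bjmp {l : ℕ} (hu : I[p]? = some (.bjmp l)) (hl : l < p + 1)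
    (h : TermFrom I (.running (p + 1 - l) s) r) : TermFrom I (.running (p + 1) s) r :=
  .of_step (by simpa [step, hu, hl] using h)

theorem termFrom_termT (hu : I[p]? = some .termT) : TermFrom I (.running (p + 1) s) true :=
  .of_step (by simp [step, hu, termFrom_terminated])

theorem termFrom_termF (hu : I[p]? = some .termF) : TermFrom I (.running (p + 1) s) false :=
  .of_step (by simp [step, hu, termFrom_terminated])

theorem termFrom_set {f : Focus} {x y : Bool} (hs : s f = some x)
    (hu : I[p]? = some (.neg f (if y then .setT else .setF)))
    (h : TermFrom I (.running (p + 3) (Function.update s f (some y))) r) :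
    TermFrom I (.running (p + 1) s) r := by
  have hupd : updSt s f (if y then .setT else .setF) = Function.update s f (some y) := by
    funext g
    by_cases hg : g = f <;> cases y <;> simp [updSt, procEff, hs, hg]
  have hrep : procReply (if y then .setT else .setF) (s f) = some true := by
    cases y <;> simp [procReply, hs]
  exact .of_step (by simpa [step, hu, hrep, hupd] using h)

theorem termFrom_polTest {f : Focus} {x y : Bool} (hs : s f = some x)
    (hu : I[p]? = some (polTest y f))
    (h : TermFrom I (.running (if x = y then p + 2 else p + 3) s) r) :
    TermFrom I (.running (p + 1) s) r := by
  refine .of_step ?_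
  cases x <;> cases y <;> simpa [step, hu, hs, polTest, procReply, updSt_get] using h

end Steps

/-- The state contains the input `b` and the bits of the number `v`. -/
structure Holds (k K : ℕ) (b : List Bool) (v : ℕ → Bool) (s : St) : Prop where
  inp : ∀ j < K, s (.inp (j + 1)) = some (b.getD j false)
  aux : ∀ i < k, s (.aux (i + 1)) = some (v i)

/-- The assignment `a` satisfies the selected clauses with number greater than `j`. -/
def SatFrom (K : ℕ) (φ : ℕ → ℕ × ℕ × ℕ × ℕ) (b : List Bool) (a : ℕ → Bool) (j : ℕ) : Prop :=
  ∀ m, j < m → m ≤ K → b.getD (m - 1) false = true → SatClause a (φ m)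

theorem satFrom_iff {b : List Bool} {a : ℕ → Bool} {j : ℕ} (hj : j < K) :
    SatFrom K φ b a j ↔
      (b.getD j false = true → SatClause a (φ (j + 1))) ∧ SatFrom K φ b a (j + 1) := by
  constructor
  · exact fun h => ⟨fun hb => h (j + 1) (by omega) hj (by simpa using hb),
      fun m hm => h m (by omega)⟩
  · rintro ⟨h1, h2⟩ m hm hmK hb
    rcases (Nat.succ_le_of_lt hm).eq_or_lt with rfl | hlt
    · exact h1 (by simpa using hb)
    · exact h2 m hlt hmK hb

theorem termFrom_clause {b : List Bool} {v : ℕ → Bool} {s : St} {r : Bool} {j : ℕ} (hj : j < K)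
    (hφ : φ (j + 1) ∈ Set.Icc 1 k ×ˢ Set.Icc 1 k ×ˢ Set.Icc 1 k ×ˢ Set.Icc 1 8)
    (hs : Holds k K b v s)
    (hnext : (b.getD j false = true → SatClause (fun i => v (i - 1)) (φ (j + 1))) →
      TermFrom (prog k K φ) (.running (4 * k + 3 + 8 * (j + 1)) s) r)
    (hfail : ¬ (b.getD j false = true → SatClause (fun i => v (i - 1)) (φ (j + 1))) →
      TermFrom (prog k K φ) (.running 2 s) r) :
    TermFrom (prog k K φ) (.running (4 * k + 3 + 8 * j) s) r := by
  have hp (q : ℕ) (hq : q < 8) := prog_clause (k := k) (φ := φ) hj hq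
  generalize φ (j + 1) = c at hφ hnext hfail hp
  obtain ⟨l, m, n, i⟩ := c
  obtain ⟨⟨hl1, hl2⟩, ⟨hm1, hm2⟩, ⟨hn1, hn2⟩, -⟩ := hφ
  simp only [SatClause] at hl1 hl2 hm1 hm2 hn1 hn2 hnext hfail
  have haux (x : ℕ) (h1 : 1 ≤ x) (h2 : x ≤ k) : s (.aux x) = some (v (x - 1)) := by
    have := hs.aux (x - 1) (by omega)
    rwa [Nat.sub_add_cancel h1] at this
  have e1 : 4 * k + 3 + 8 * j = 4 * k + 2 + 8 * j + 0 + 1 := by omega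
  have e2 : 4 * k + 3 + 8 * (j + 1) = 4 * k + 2 + 8 * j + 9 := by omega
  rw [e2] at hnext
  rw [e1]
  refine termFrom_polTest (y := false) (hs.inp j hj) (hp 0 (by omega)) ?_
  split_ifs with hb
  · refine termFrom_fjmp (hp 1 (by omega)) (hnext fun h => absurd (hb.symm.trans h) (by simp))
  refine termFrom_polTest (haux l hl1 hl2) (hp 2 (by omega)) ?_
  split_ifs with h1
  · exact termFrom_fjmp (hp 3 (by omega)) (hnext fun _ => Or.inl h1)
  refine termFrom_polTest (haux m hm1 hm2) (hp 4 (by omega)) ?_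
  split_ifs with h2
  · exact termFrom_fjmp (hp 5 (by omega)) (hnext fun _ => Or.inr (Or.inl h2))
  refine termFrom_polTest (haux n hn1 hn2) (hp 6 (by omega)) ?_
  split_ifs with h3
  · refine termFrom_bjmp (hp 7 (by omega)) (by omega) ?_
    rw [show 4 * k + 2 + 8 * j + 7 + 1 - (4 * k + 8 * j + 8) = 2 by omega]
    refine hfail fun h => ?_
    rcases h (by simpa using hb) with h | h | h
    · exact h1 h
    · exact h2 h
    · simp [h] at h3
  · refine hnext fun _ => Or.inr (Or.inr ?_)
    revert h3
    cases v (n - 1) <;> cases sgn3 i <;> simp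

theorem termFrom_check {b : List Bool} {v : ℕ → Bool} {s : St} {r : Bool}
    (hφ : ∀ j < K, φ (j + 1) ∈ Set.Icc 1 k ×ˢ Set.Icc 1 k ×ˢ Set.Icc 1 k ×ˢ Set.Icc 1 8)
    (hs : Holds k K b v s) {j : ℕ} (hj : j ≤ K)
    (hsat : SatFrom K φ b (fun i => v (i - 1)) j → r = true)
    (hunsat : ¬ SatFrom K φ b (fun i => v (i - 1)) j → TermFrom (prog k K φ) (.running 2 s) r) :
    TermFrom (prog k K φ) (.running (4 * k + 3 + 8 * j) s) r := by
  induction hj using Nat.decreasingInduction with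
  | self =>
    obtain rfl := hsat fun m h1 h2 => by omega
    rw [show 4 * k + 3 + 8 * K = 4 * k + 2 + 8 * K + 1 by omega]
    exact termFrom_termT prog_termT
  | of_succ j hj ih =>
    rw [satFrom_iff hj] at hsat hunsat
    refine termFrom_clause hj (hφ j hj) hs (fun h => ih ?_ ?_) fun h => hunsat (h ·.1)
    · exact fun h' => hsat ⟨h, h'⟩
    · exact fun h' => hunsat (h' ·.2)

theorem testBit_sub_one {i v : ℕ} (h0 : ∀ j < i, v.testBit j = false) (h1 : v.testBit i = true)
    (j : ℕ) : (v - 1).testBit j = if j < i then true else if j = i then false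
      else v.testBit j := by
  induction i generalizing v j with
  | zero =>
    simp only [Nat.testBit_zero, decide_eq_true_eq] at h1
    cases j with
    | zero =>
      simp only [Nat.testBit_zero]
      simp
      omega
    | succ j => simp [Nat.testBit_succ, show (v - 1) / 2 = v / 2 by omega]
  | succ i ih =>
    have hv : v ≠ 0 := by
      rintro rfl
      simp at h1
    have h2 := h0 0 (by omega)
    simp only [Nat.testBit_zero, decide_eq_false_iff_not] at h2
    cases j with
    | zero =>
      simp only [Nat.testBit_zero]
      simp
      omega
    | succ j =>
      rw [Nat.testBit_succ, show (v - 1) / 2 = v / 2 - 1 by omega,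
        ih (fun j hj => by rw [← Nat.testBit_succ]; exact h0 _ (by omega))
          (by rwa [← Nat.testBit_succ])]
      simp [Nat.testBit_succ]

theorem Holds.update {b : List Bool} {v : ℕ → Bool} {s : St} (hs : Holds k K b v s) (i : ℕ)
    (x : Bool) : Holds k K b (Function.update v i x)
      (Function.update s (.aux (i + 1)) (some x)) where
  inp j hj := by simpa using hs.inp j hj
  aux j hj := by
    by_cases h : j = i
    · simp [h]
    · simpa [h] using hs.aux j hj

theorem Holds.congr {b : List Bool} {v w : ℕ → Bool} {s : St} (hs : Holds k K b v s)
    (h : ∀ i < k, v i = w i) : Holds k K b w s where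
  inp := hs.inp
  aux i hi := by rw [hs.aux i hi, h i hi]

theorem termFrom_dec {b : List Bool} {v : ℕ} {s : St} {r : Bool} (hv : v < 2 ^ k) {i : ℕ}
    (hi : i ≤ k) (hlow : ∀ j < i, v.testBit j = false)
    (hs : Holds k K b (fun j => if j < i then true else v.testBit j) s)
    (hzero : v = 0 → r = false)
    (hpos : v ≠ 0 → ∀ s', Holds k K b (v - 1).testBit s' →
      TermFrom (prog k K φ) (.running (4 * k + 3) s') r) :
    TermFrom (prog k K φ) (.running (4 * i + 2) s) r := by
  induction hi using Nat.decreasingInduction generalizing s with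
  | self =>
    have : v = 0 := Nat.eq_of_testBit_eq fun j => by
      rcases lt_or_ge j k with h | h
      · simpa using hlow j h
      · simpa using Nat.testBit_eq_false_of_lt (hv.trans_le (Nat.pow_le_pow_right (by omega) h))
    rw [hzero this]
    exact termFrom_termF prog_termF
  | of_succ i hi ih =>
    have hp (q : ℕ) (hq : q < 4) := prog_dec (k := k) (K := K) (φ := φ) hi hq
    have hsi := hs.aux i hi
    simp only [lt_irrefl, if_false] at hsi
    rw [show 4 * i + 2 = 1 + 4 * i + 0 + 1 by omega]
    refine termFrom_polTest (y := true) hsi (hp 0 (by omega)) ?_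
    split_ifs with hbit
    · refine termFrom_set (y := false) hsi (hp 1 (by omega)) ?_
      refine termFrom_fjmp (hp 3 (by omega)) ?_
      rw [show 1 + 4 * i + 3 + 1 + (4 * (k - i) - 2) = 4 * k + 3 by omega]
      refine hpos ?_ _ ((hs.update i false).congr fun j hj => ?_)
      · rintro rfl
        simp at hbit
      · rw [testBit_sub_one hlow hbit]
        by_cases h : j = i
        · simp [h]
        · simp [h]
    · refine termFrom_set (y := true) hsi (hp 2 (by omega)) ?_
      rw [show 1 + 4 * i + 2 + 3 = 4 * (i + 1) + 2 by omega]
      refine ih (fun j hj => ?_) ((hs.update i true).congr fun j hj => ?_)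
      · rcases (Nat.le_of_lt_succ hj).eq_or_lt with rfl | h
        · simpa using hbit
        · exact hlow j h
      · by_cases h : j = i
        · simp [h]
        · simp [h, show j < i + 1 ↔ j < i by omega]

/-- The assignment given by the bits of `v` satisfies all selected clauses. -/
def SatBits (K : ℕ) (φ : ℕ → ℕ × ℕ × ℕ × ℕ) (b : List Bool) (v : ℕ) : Prop :=
  SatFrom K φ b (fun i => v.testBit (i - 1)) 0

theorem termFrom_search {b : List Bool} {r : Bool}
    (hφ : ∀ j < K, φ (j + 1) ∈ Set.Icc 1 k ×ˢ Set.Icc 1 k ×ˢ Set.Icc 1 k ×ˢ Set.Icc 1 8)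
    {v : ℕ} (hv : v < 2 ^ k) {s : St} (hs : Holds k K b v.testBit s)
    (hr : r = true ↔ ∃ w ≤ v, SatBits K φ b w) :
    TermFrom (prog k K φ) (.running (4 * k + 3) s) r := by
  induction v generalizing s with
  | zero =>
    refine termFrom_check hφ hs (Nat.zero_le _) (fun h => hr.2 ⟨0, le_rfl, h⟩) fun h => ?_
    refine termFrom_dec (i := 0) hv (Nat.zero_le _) (by simp) (hs.congr (by simp)) (fun _ => ?_)
      (by simp)
    rw [← Bool.not_eq_true, hr]
    rintro ⟨w, hw, h'⟩
    obtain rfl := Nat.le_zero.1 hw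
    exact h h'
  | succ v ih =>
    refine termFrom_check hφ hs (Nat.zero_le _) (fun h => hr.2 ⟨_, le_rfl, h⟩) fun h => ?_
    refine termFrom_dec (i := 0) hv (Nat.zero_le _) (by simp) (hs.congr (by simp)) (by simp)
      fun _ s' hs' => ih (by omega) hs' (hr.trans ⟨?_, ?_⟩)
    · rintro ⟨w, hw, h'⟩
      rcases hw.eq_or_lt with rfl | hlt
      · exact absurd h' h
      · exact ⟨w, by omega, h'⟩
    · rintro ⟨w, hw, h'⟩
      exact ⟨w, by omega, h'⟩

theorem satFormula_iff {b : List Bool}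
    (hφ : ∀ j < 8 * k ^ 3, φ (j + 1) ∈
      Set.Icc 1 k ×ˢ Set.Icc 1 k ×ˢ Set.Icc 1 k ×ˢ Set.Icc 1 8) :
    SatFormula k φ b ↔ ∃ w ≤ 2 ^ k - 1, SatBits (8 * k ^ 3) φ b w := by
  constructor
  · rintro ⟨a, ha⟩
    have hlt := Nat.ofBits_lt_two_pow fun i : Fin k => a (i + 1)
    refine ⟨Nat.ofBits fun i : Fin k => a (i + 1), by omega, fun m h1 h2 hb => ?_⟩
    have hm := ha m h1 h2 hb
    have hmem := hφ (m - 1) (by omega)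
    rw [Nat.sub_add_cancel h1] at hmem
    have hbit (x : ℕ) (hx1 : 1 ≤ x) (hx2 : x ≤ k) :
        (Nat.ofBits fun i : Fin k => a (i + 1)).testBit (x - 1) = a x := by
      rw [Nat.testBit_ofBits_lt _ _ (by omega)]
      simp [Nat.sub_add_cancel hx1]
    generalize φ m = c at hm hmem
    obtain ⟨x, y, z, i⟩ := c
    obtain ⟨⟨hx1, hx2⟩, ⟨hy1, hy2⟩, ⟨hz1, hz2⟩, -⟩ := hmem
    simp only [SatClause] at hm ⊢
    rwa [hbit x hx1 hx2, hbit y hy1 hy2, hbit z hz1 hz2]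
  · rintro ⟨w, -, hw⟩
    exact ⟨_, fun m h1 h2 => hw m h1 h2⟩

theorem computes_prog
    (hφ : ∀ j < 8 * k ^ 3, φ (j + 1) ∈
      Set.Icc 1 k ×ˢ Set.Icc 1 k ×ˢ Set.Icc 1 k ×ˢ Set.Icc 1 8)
    {F : (Fin (8 * k ^ 3) → Bool) → Bool}
    (hF : ∀ b, F b = true ↔ SatFormula k φ (List.ofFn b)) :
    Computes (prog k (8 * k ^ 3) φ) (8 * k ^ 3) k fun b => some (F b) := by
  refine fun b => ⟨fun r hr => ?_, fun h => by cases h⟩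
  cases hr
  have hpos : 0 < 2 ^ k := by positivity
  refine termFrom_fjmp prog_zero ?_
  rw [show 0 + 1 + (4 * k + 2) = 4 * k + 3 by omega]
  refine termFrom_search (b := List.ofFn b) (v := 2 ^ k - 1) hφ (by omega) ⟨?_, ?_⟩
    ((hF b).trans (satFormula_iff hφ))
  · intro j hj
    simp [initSt, hj, Nat.succ_le_of_lt hj, List.getD_eq_getElem?_getD]
  · intro i hi
    simp [initSt, hi, Nat.succ_le_of_lt hi]

end Search

theorem threeSATstar_eq_true_iff (φ : ℕ → ℕ → ℕ × ℕ × ℕ × ℕ) {k : ℕ} (hk : 1 ≤ k)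
    {b : List Bool} (hb : b.length = 8 * k ^ 3) :
    threeSATstar φ b = true ↔ SatFormula k (φ k) b := by
  have h : ∃ k : ℕ, 1 ≤ k ∧ b.length = 8 * k ^ 3 := ⟨k, hk, hb⟩
  have hc : h.choose = k := by
    have := h.choose_spec.2
    exact Nat.pow_left_injective (n := 3) (by omega) (by simp only; omega)
  simp [threeSATstar, h, hc]

theorem exists_polynomial_computes_threeSATstar (φ : ℕ → ℕ → ℕ × ℕ × ℕ × ℕ)
    (hφ : ∀ k : ℕ, 1 ≤ k → Set.MapsTo (φ k) (Set.Icc 1 (8 * k ^ 3))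
      (Set.Icc 1 k ×ˢ Set.Icc 1 k ×ˢ Set.Icc 1 k ×ˢ Set.Icc 1 8)) :
    ∃ h : Polynomial ℕ, ∀ n : ℕ, ∃ I : List Instr, I ≠ [] ∧ I.length ≤ h.eval n ∧
      ∃ l : ℕ, Computes I n l (fun b => some (threeSATstar φ (List.ofFn b))) := by
  refine ⟨12 * Polynomial.X + 3, fun n => ?_⟩
  by_cases hn : ∃ k : ℕ, 1 ≤ k ∧ n = 8 * k ^ 3
  · obtain ⟨k, hk, rfl⟩ := hn
    refine ⟨Search.prog k (8 * k ^ 3) (φ k), ?_, ?_, k,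
      Search.computes_prog (fun j hj => hφ k hk ⟨by omega, by omega⟩)
        fun b => threeSATstar_eq_true_iff φ hk (by simp)⟩
    · simp [Search.prog]
    · have : k ≤ k ^ 3 := Nat.le_self_pow (by omega) k
      simp [Search.prog]
      omega
  · refine ⟨[.termF], by simp, by simp, 0, fun b => ⟨fun r hr => ?_, fun h => by cases h⟩⟩
    have hf : threeSATstar φ (List.ofFn b) = false := by
      unfold threeSATstar
      rw [dif_neg (by simpa using hn)]
    obtain rfl : false = r := by simpa [hf] using hr
    exact Search.termFrom_termF (p := 0) rfl

theorem exists_polynomial_circuits_of_loopFree (φ : ℕ → ℕ → ℕ × ℕ × ℕ × ℕ)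
    (h : ∃ h' : Polynomial ℕ, ∀ n : ℕ,
      ∃ I : List Instr, I ≠ [] ∧ LoopFree I ∧ I.length ≤ h'.eval n ∧
        ∃ l : ℕ, Computes I n l (fun b => some (threeSATstar φ (List.ofFn b)))) :
    ∃ p : Polynomial ℕ, ∀ k : ℕ, 1 ≤ k →
      ∃ C : List Gate, CircuitWF (8 * k ^ 3) C ∧ C.length ≤ p.eval (8 * k ^ 3) ∧
        ∀ b : Fin (8 * k ^ 3) → Bool, (circuitVal (8 * k ^ 3) b C = true ↔
          SatFormula k (φ k) (List.ofFn b)) := by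
  obtain ⟨h', hh⟩ := h
  refine ⟨7 * h' + 4, fun k hk => ?_⟩
  obtain ⟨I, -, hlf, hlen, l, hc⟩ := hh (8 * k ^ 3)
  have hK : 1 ≤ 8 * k ^ 3 := by
    have : 0 < k ^ 3 := by positivity
    omega
  obtain ⟨C, hC, hCl, hCv⟩ := exists_circuit_of_loopFree hlf hK hc
  refine ⟨C, hC, ?_, fun b => ?_⟩
  · simp only [Polynomial.eval_add, Polynomial.eval_mul, Polynomial.eval_ofNat]
    omega
  · rw [hCv b]
    exact threeSATstar_eq_true_iff φ hk (by simp)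

/-- If `3SAT` has no polynomial-size Boolean circuits, then `3SAT*` is computable by
polynomial-length instruction sequences but not by polynomial-length loop-free
instruction sequences; consequently `IS^lf_P ⊊ IS_P`. -/
theorem statement9 (φ : ℕ → ℕ → ℕ × ℕ × ℕ × ℕ)
    (hφ : ∀ k : ℕ, 1 ≤ k → Set.BijOn (φ k) (Set.Icc 1 (8 * k ^ 3))
      (Set.Icc 1 k ×ˢ Set.Icc 1 k ×ˢ Set.Icc 1 k ×ˢ Set.Icc 1 8))
    (hhard : ¬ ∃ p : Polynomial ℕ, ∀ k : ℕ, 1 ≤ k →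
      ∃ C : List Gate, CircuitWF (8 * k ^ 3) C ∧ C.length ≤ p.eval (8 * k ^ 3) ∧
        ∀ b : Fin (8 * k ^ 3) → Bool,
          circuitVal (8 * k ^ 3) b C
            = (if SatFormula k (φ k) (List.ofFn b) then true else false)) :
    (∃ h : Polynomial ℕ, ∀ n : ℕ,
      ∃ I : List Instr, I ≠ [] ∧ I.length ≤ h.eval n ∧
        ∃ l : ℕ, Computes I n l
          (fun b => some (threeSATstar φ (List.ofFn b)))) ∧
    (¬ ∃ h' : Polynomial ℕ, ∀ n : ℕ,
      ∃ I : List Instr, I ≠ [] ∧ LoopFree I ∧ I.length ≤ h'.eval n ∧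
        ∃ l : ℕ, Computes I n l
          (fun b => some (threeSATstar φ (List.ofFn b)))) ∧
    {F : List Bool → Option Bool | ISlfP F} ⊂ {F : List Bool → Option Bool | ISP F} := by
  have hupper := exists_polynomial_computes_threeSATstar φ fun k hk => (hφ k hk).mapsTo
  have hlower := mt (exists_polynomial_circuits_of_loopFree φ) fun ⟨p, hp⟩ => hhard ⟨p,
    fun k hk => by
      obtain ⟨C, hC, hl, hv⟩ := hp k hk
      refine ⟨C, hC, hl, fun b => ?_⟩
      rw [Bool.eq_iff_iff, hv b]
      simp⟩
  refine ⟨hupper, hlower, ?_, fun h => hlower ?_⟩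
  · rintro F ⟨p, hp⟩
    refine ⟨p, fun k => ?_⟩
    obtain ⟨I, hne, -, h⟩ := hp k
    exact ⟨I, hne, h⟩
  · exact h (a := fun b => some (threeSATstar φ b)) hupper
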